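/- Fix 0 < ε < 1. There exists Δ₀ such that for every Δ ≥ Δ₀ the following holds, where δ = (192 log Δ)^{2/ε}. Let G be a finite triangle-free simple graph of maximum degree at most Δ and let ℋ = (L, H) be a cover of G with |L(u)| = k(u) := ⌈(1+ε)·max{deg(u)/log deg(u), δ/log δ}⌉ for all u ∈ V(G), and set ℓ(u) = max{deg(u)^{ε/2}, δ^{ε/2}}. Fix a vertex u ∈ V(G) and an independent set J ⊆ L(V(G) \ N_G[u]) of H. Let 𝐈′ be a uniformly random independent subset of L_J(N_G(u)) (i.e. uniformly random over all independent sets of H contained in ⋃_{v∈N_G(u)} L_J(v)) and let 𝐈 = J ∪ 𝐈′. Then (1) Pr(|L_𝐈(u)| < ℓ(u)) ≤ Δ^{-3}/8, and (2) Pr(∃ c ∈ L_𝐈(u) with deg*_{ℋ_𝐈}(c) > 24·log Δ) ≤ Δ^{-3}/8. -/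

import Mathlib

/-- A finite set of vertices is independent in `G`. -/
def IndepFinset {V : Type*} (G : SimpleGraph V) (s : Finset V) : Prop :=
  ∀ u ∈ s, ∀ v ∈ s, ¬ G.Adj u v

instance {V : Type*} (G : SimpleGraph V) [DecidableRel G.Adj] (s : Finset V) :
    Decidable (IndepFinset G s) :=
  inferInstanceAs (Decidable (∀ u ∈ s, ∀ v ∈ s, ¬ G.Adj u v))

/-- `(L, H)` is a cover of the graph `G` (in the sense of correspondence/DP-colouring):
(1) the sets `L u` partition the vertices of `H`; (2) each `L u` induces a complete
subgraph of `H`; (3) edges of `H` only join colours of a vertex or of adjacent vertices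
of `G`; (4) for adjacent `u v`, the edges of `H` between `L u` and `L v` form a matching. -/
def IsCover {V U : Type*} (G : SimpleGraph V) (H : SimpleGraph U) (L : V → Finset U) :
    Prop :=
  (∀ c : U, ∃! u : V, c ∈ L u) ∧
  (∀ u : V, ∀ c ∈ L u, ∀ d ∈ L u, c ≠ d → H.Adj c d) ∧
  (∀ c d : U, H.Adj c d → ∀ u v : V, c ∈ L u → d ∈ L v → u = v ∨ G.Adj u v) ∧
  (∀ u v : V, G.Adj u v →
    ∀ c ∈ L u, ∀ d ∈ L v, ∀ d' ∈ L v, H.Adj c d → H.Adj c d' → d = d')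

/-- The degree `deg*_ℋ(c)` of a colour `c` in the cross-edge subgraph `H*` of the cover:
the number of `H`-neighbours of `c` lying in a part different from that of `c`. -/
def degStar {V U : Type*} [Fintype V] [Fintype U] [DecidableEq U]
    (H : SimpleGraph U) [DecidableRel H.Adj] (L : V → Finset U) (c : U) : ℕ :=
  (Finset.univ.filter fun d : U => H.Adj c d ∧ ∀ u : V, c ∈ L u → d ∉ L u).card

/-- The closed neighbourhood `N_H[I]` of a set `I` of vertices of `H`. -/
def closedNbhd {U : Type*} [Fintype U] [DecidableEq U]
    (H : SimpleGraph U) [DecidableRel H.Adj] (I : Finset U) : Finset U :=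
  I ∪ I.biUnion (fun x => H.neighborFinset x)

/-- The reduced list `L_I(u) = L(u) \ N_H(I)` of the cover `ℋ_I`. -/
def coverLI {V U : Type*} [Fintype U] [DecidableEq U]
    (H : SimpleGraph U) [DecidableRel H.Adj] (L : V → Finset U) (I : Finset U)
    (u : V) : Finset U :=
  L u \ I.biUnion (fun x => H.neighborFinset x)

/-- The domain `dom(I) = {u ∈ V(G) : I ∩ L(u) ≠ ∅}` of an independent set `I` of `H`;
`G_I = G - dom(I)`. -/
def domI {V U : Type*} [Fintype V] [DecidableEq U] (L : V → Finset U) (I : Finset U) :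
    Finset V :=
  Finset.univ.filter fun u : V => (I ∩ L u).Nonempty

/-- The degree `deg*_{ℋ_I}(c)` of a colour `c` in the cross-edge subgraph of the cover
`ℋ_I = (L_I, H_I)`, where `H_I = H - N_H[I]`: the number of `H`-neighbours of `c`
surviving in `H_I` and lying in a part different from that of `c`. -/
def degStarI {V U : Type*} [Fintype V] [Fintype U] [DecidableEq U]
    (H : SimpleGraph U) [DecidableRel H.Adj] (L : V → Finset U) (I : Finset U)
    (c : U) : ℕ :=
  (Finset.univ.filter fun d : U =>
    H.Adj c d ∧ d ∉ closedNbhd H I ∧ ∀ u : V, c ∈ L u → d ∉ L u).card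

open scoped Classical

/-- Independent sets of `H` contained in the union of the lists `A v`, `v ∈ N`. -/
noncomputable def indSets {V U : Type} [Fintype U] [DecidableEq U]
    (H : SimpleGraph U) (A : V → Finset U) (N : Finset V) : Finset (Finset U) :=
  Finset.univ.filter fun I => IndepFinset H I ∧ I ⊆ N.biUnion A

/-- The lists over `N₀` are disjoint cliques with no edges in between. -/
def GoodLists {V U : Type} (H : SimpleGraph U) (A : V → Finset U) (N₀ : Finset V) : Prop :=
  (∀ v ∈ N₀, ∀ c ∈ A v, ∀ d ∈ A v, c ≠ d → H.Adj c d) ∧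
  (∀ v ∈ N₀, ∀ w ∈ N₀, v ≠ w → ∀ c ∈ A v, c ∉ A w) ∧
  (∀ v ∈ N₀, ∀ w ∈ N₀, v ≠ w → ∀ c ∈ A v, ∀ d ∈ A w, ¬ H.Adj c d)

theorem GoodLists.mono {V U : Type} {H : SimpleGraph U} {A : V → Finset U}
    {N M : Finset V} (h : GoodLists H A M) (hs : N ⊆ M) : GoodLists H A N :=
  ⟨fun v hv => h.1 v (hs hv), fun v hv w hw => h.2.1 v (hs hv) w (hs hw),
    fun v hv w hw => h.2.2 v (hs hv) w (hs hw)⟩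

theorem mem_indSets {V U : Type} [Fintype U] [DecidableEq U]
    {H : SimpleGraph U} {A : V → Finset U} {N : Finset V} {I : Finset U} :
    I ∈ indSets H A N ↔ IndepFinset H I ∧ I ⊆ N.biUnion A := by
  simp [indSets]

theorem indSets_not_mem {V U : Type} [Fintype U] [DecidableEq U]
    {H : SimpleGraph U} {A : V → Finset U} {N : Finset V} {v : V} (hv : v ∉ N)
    (hg : GoodLists H A (insert v N)) {I : Finset U} (hI : I ∈ indSets H A N)
    {d : U} (hd : d ∈ A v) : d ∉ I := by
  intro hdI
  have := (mem_indSets.1 hI).2 hdI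
  rw [Finset.mem_biUnion] at this
  obtain ⟨w, hw, hdw⟩ := this
  exact hg.2.1 v (by simp) w (by simp [hw]) (by rintro rfl; exact hv hw) d hd hdw

theorem sum_indSets_insert {V U : Type} [Fintype U] [DecidableEq U]
    {H : SimpleGraph U} {A : V → Finset U} {N : Finset V} {v : V} (hv : v ∉ N)
    (hg : GoodLists H A (insert v N)) (F : Finset U → ℝ) :
    ∑ I ∈ indSets H A (insert v N), F I =
      ∑ I ∈ indSets H A N, (F I + ∑ d ∈ A v, F (insert d I)) := by
  have hne : ∀ w ∈ N, v ≠ w := by rintro w hw rfl; exact hv hw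
  rw [Finset.sum_add_distrib,
    ← Finset.sum_filter_add_sum_filter_not (indSets H A (insert v N)) (fun I => ∀ d ∈ A v, d ∉ I)]
  congr 1
  · apply Finset.sum_congr _ (fun _ _ => rfl)
    ext I
    rw [Finset.mem_filter]
    constructor
    · rintro ⟨h, h2⟩
      rw [mem_indSets] at h ⊢
      refine ⟨h.1, fun x hx => ?_⟩
      have := h.2 hx
      rw [Finset.biUnion_insert, Finset.mem_union] at this
      rcases this with h3 | h3
      · exact absurd hx (h2 x h3)
      · exact h3
    · intro h
      refine ⟨?_, fun d hd => indSets_not_mem hv hg h hd⟩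
      rw [mem_indSets] at h ⊢
      refine ⟨h.1, h.2.trans ?_⟩
      rw [Finset.biUnion_insert]
      exact Finset.subset_union_right
  · rw [← Finset.sum_product']
    symm
    refine Finset.sum_bij (fun p _ => insert p.2 p.1) ?_ ?_ ?_ ?_
    · rintro ⟨I, d⟩ hp
      rw [Finset.mem_product] at hp
      obtain ⟨hI, hd⟩ := hp
      simp only at hI hd ⊢
      rw [Finset.mem_filter]
      refine ⟨?_, fun h => h d hd (by simp)⟩
      rw [mem_indSets] at hI ⊢
      have hx : ∀ x ∈ I, ¬ H.Adj d x := by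
        intro x hx
        have := hI.2 hx
        rw [Finset.mem_biUnion] at this
        obtain ⟨w, hw, hxw⟩ := this
        exact hg.2.2 v (by simp) w (by simp [hw]) (hne w hw) d hd x hxw
      constructor
      · intro a ha b hb hab
        rw [Finset.mem_insert] at ha hb
        rcases ha with rfl | ha <;> rcases hb with rfl | hb
        · exact H.irrefl hab
        · exact hx b hb hab
        · exact hx a ha hab.symm
        · exact hI.1 a ha b hb hab
      · rw [Finset.biUnion_insert]
        intro a ha
        rw [Finset.mem_insert] at ha
        rw [Finset.mem_union]
        rcases ha with rfl | ha
        · exact Or.inl hd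
        · exact Or.inr (hI.2 ha)
    · rintro ⟨I, d⟩ hp ⟨I', d'⟩ hp' heq
      rw [Finset.mem_product] at hp hp'
      simp only at hp hp' heq
      have h1 : d = d' := by
        have : d ∈ insert d' I' := heq ▸ Finset.mem_insert_self d I
        rw [Finset.mem_insert] at this
        exact this.resolve_right (indSets_not_mem hv hg hp'.1 hp.2)
      subst h1
      have h2 : I = I' := by
        rw [← Finset.erase_insert (indSets_not_mem hv hg hp.1 hp.2), heq,
          Finset.erase_insert (indSets_not_mem hv hg hp'.1 hp.2)]
      rw [h2]
    · intro I hI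
      rw [Finset.mem_filter] at hI
      obtain ⟨hI, h2⟩ := hI
      push Not at h2
      obtain ⟨d, hd, hdI⟩ := h2
      rw [mem_indSets] at hI
      refine ⟨(I.erase d, d), ?_, Finset.insert_erase hdI⟩
      rw [Finset.mem_product]
      refine ⟨?_, hd⟩
      rw [mem_indSets]
      refine ⟨fun a ha b hb => hI.1 a (Finset.mem_of_mem_erase ha) b (Finset.mem_of_mem_erase hb),
        fun a ha => ?_⟩
      rw [Finset.mem_erase] at ha
      have := hI.2 ha.2
      rw [Finset.biUnion_insert, Finset.mem_union] at this
      rcases this with h3 | h3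
      · exact absurd (hg.1 v (by simp) a h3 d hd ha.1) (hI.1 a ha.2 d hdI)
      · exact h3
    · intros; rfl

theorem card_indSets_insert {V U : Type} [Fintype U] [DecidableEq U]
    {H : SimpleGraph U} {A : V → Finset U} {N : Finset V} {v : V} (hv : v ∉ N)
    (hg : GoodLists H A (insert v N)) :
    ((indSets H A (insert v N)).card : ℝ) = (indSets H A N).card * ((A v).card + 1) := by
  have := sum_indSets_insert hv hg (fun _ => 1)
  simp only [Finset.sum_const, nsmul_eq_mul, mul_one] at this
  rw [this]; ring

/-- Indicator that the colour `c` has no neighbour in `I`. -/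
noncomputable def surv {U : Type} (H : SimpleGraph U) (I : Finset U) (c : U) : ℝ :=
  if ∀ d ∈ I, ¬ H.Adj c d then 1 else 0

theorem surv_insert {U : Type} [DecidableEq U] (H : SimpleGraph U) (I : Finset U) (c d : U) :
    surv H (insert d I) c = surv H I c * (if H.Adj c d then 0 else 1) := by
  unfold surv
  by_cases h : H.Adj c d <;> simp [h]

theorem surv_nonneg {U : Type} (H : SimpleGraph U) (I : Finset U) (c : U) : 0 ≤ surv H I c := by
  unfold surv; split_ifs <;> norm_num

theorem surv_le_one {U : Type} (H : SimpleGraph U) (I : Finset U) (c : U) : surv H I c ≤ 1 := by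
  unfold surv; split_ifs <;> norm_num

theorem prod_add_ge {U : Type} [DecidableEq U] (C : Finset U) (a b : U → ℝ)
    (ha : ∀ c ∈ C, 0 ≤ a c) (hb : ∀ c ∈ C, 0 ≤ b c) :
    ∏ c ∈ C, a c + ∑ c ∈ C, b c * ∏ x ∈ C.erase c, a x ≤ ∏ c ∈ C, (a c + b c) := by
  induction C using Finset.induction_on with
  | empty => simp
  | insert x C hx ih =>
    have ih' := ih (fun c hc => ha c (by simp [hc])) (fun c hc => hb c (by simp [hc]))
    rw [Finset.prod_insert hx, Finset.prod_insert hx, Finset.sum_insert hx, Finset.erase_insert hx]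
    have h1 : ∑ c ∈ C, b c * ∏ y ∈ (insert x C).erase c, a y =
        a x * ∑ c ∈ C, b c * ∏ y ∈ C.erase c, a y := by
      rw [Finset.mul_sum]
      refine Finset.sum_congr rfl fun c hc => ?_
      have hcx : x ≠ c := by rintro rfl; exact hx hc
      rw [Finset.erase_insert_of_ne hcx, Finset.prod_insert (by simp [hx])]
      ring
    rw [h1]
    have hax := ha x (by simp)
    have hbx := hb x (by simp)
    have h2 : 0 ≤ ∑ c ∈ C, b c * ∏ y ∈ C.erase c, a y := by
      refine Finset.sum_nonneg fun c hc => mul_nonneg (hb c (by simp [hc])) ?_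
      refine Finset.prod_nonneg fun y hy => ha y ?_
      simp [Finset.mem_of_mem_erase hy]
    nlinarith [mul_le_mul_of_nonneg_left ih' (add_nonneg hax hbx), mul_nonneg hbx h2]

/-- number of neighbours of `c` in `A`. -/
noncomputable def nn {U : Type} (H : SimpleGraph U) (A : Finset U) (c : U) : ℝ :=
  ∑ d ∈ A, if H.Adj c d then 1 else 0

theorem nn_nonneg {U : Type} (H : SimpleGraph U) (A : Finset U) (c : U) : 0 ≤ nn H A c := by
  unfold nn; exact Finset.sum_nonneg fun d _ => by split_ifs <;> norm_num

theorem nn_le {U : Type} (H : SimpleGraph U) (A : Finset U) (c : U) : nn H A c ≤ A.card := by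
  unfold nn
  calc _ ≤ ∑ d ∈ A, (1:ℝ) := Finset.sum_le_sum fun d _ => by split_ifs <;> norm_num
    _ = _ := by simp

theorem one_step {U : Type} [DecidableEq U] (H : SimpleGraph U) (A C : Finset U)
    (hm : ∀ d ∈ A, ∀ c ∈ C, ∀ c' ∈ C, H.Adj c d → H.Adj c' d → c = c')
    (y : U → ℝ) (hy0 : ∀ c, 0 ≤ y c) (hy1 : ∀ c, y c ≤ 1) :
    ∏ c ∈ C, (1 - y c) + ∑ d ∈ A, ∏ c ∈ C, (1 - y c * (if H.Adj c d then 0 else 1)) ≤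
      (A.card + 1) * ∏ c ∈ C, (1 - y c * (1 - nn H A c / (A.card + 1))) := by
  have key : ∀ d ∈ A, ∏ c ∈ C, (1 - y c * (if H.Adj c d then 0 else 1)) =
      ∏ c ∈ C, (1 - y c) +
        ∑ c ∈ C, (if H.Adj c d then 1 else 0) * (y c * ∏ x ∈ C.erase c, (1 - y x)) := by
    intro d hd
    by_cases h : ∃ c ∈ C, H.Adj c d
    · obtain ⟨c, hc, hcd⟩ := h
      have hno : ∀ x ∈ C, x ≠ c → ¬ H.Adj x d := fun x hx hxc hxd => hxc (hm d hd x hx c hc hxd hcd)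
      rw [Finset.sum_eq_single_of_mem c hc (fun x hx hxc => by simp [hno x hx hxc]),
        ← Finset.mul_prod_erase C _ hc, ← Finset.mul_prod_erase C (fun c => 1 - y c) hc]
      have : ∏ x ∈ C.erase c, (1 - y x * (if H.Adj x d then 0 else 1)) =
          ∏ x ∈ C.erase c, (1 - y x) := by
        refine Finset.prod_congr rfl fun x hx => ?_
        rw [Finset.mem_erase] at hx
        simp [hno x hx.2 hx.1]
      rw [this]; simp [hcd]; ring
    · push Not at h
      rw [Finset.sum_eq_zero (fun c hc => by simp [h c hc]), add_zero]
      exact Finset.prod_congr rfl fun c hc => by simp [h c hc]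
  have hpos : (0:ℝ) < A.card + 1 := by positivity
  rw [Finset.sum_congr rfl key, Finset.sum_add_distrib, Finset.sum_comm]
  have h2 := prod_add_ge C (fun c => 1 - y c) (fun c => y c * nn H A c / (A.card + 1))
    (fun c _ => by linarith [hy1 c])
    (fun c _ => div_nonneg (mul_nonneg (hy0 c) (nn_nonneg H A c)) hpos.le)
  have h3 := mul_le_mul_of_nonneg_left h2 hpos.le
  have h4 : ∀ c, (1 - y c * (1 - nn H A c / (A.card + 1))) =
      1 - y c + y c * nn H A c / (A.card + 1) := fun c => by ring
  simp only [h4]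
  refine le_trans (le_of_eq ?_) h3
  rw [mul_add, Finset.mul_sum]
  simp only [Finset.sum_const, nsmul_eq_mul]
  have h5 : ∀ c ∈ C, ∑ d ∈ A, (if H.Adj c d then (1:ℝ) else 0) * (y c * ∏ x ∈ C.erase c, (1 - y x))
      = (A.card + 1) * (y c * nn H A c / (A.card + 1) * ∏ x ∈ C.erase c, (1 - y x)) := by
    intro c _
    rw [← Finset.sum_mul]
    change nn H A c * _ = _
    field_simp
  rw [Finset.sum_congr rfl h5]
  ring

theorem neg_corr {V U : Type} [Fintype U] [DecidableEq U]
    {H : SimpleGraph U} {A : V → Finset U} (C : Finset U) (N : Finset V)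
    (hg : GoodLists H A N)
    (hm : ∀ v ∈ N, ∀ d ∈ A v, ∀ c ∈ C, ∀ c' ∈ C, H.Adj c d → H.Adj c' d → c = c') :
    ∀ (s : U → ℝ), (∀ c, 0 ≤ s c) → (∀ c, s c ≤ 1) →
    ∑ I ∈ indSets H A N, ∏ c ∈ C, (1 - s c * surv H I c) ≤
      (indSets H A N).card *
        ∏ c ∈ C, (1 - s c * ∏ v ∈ N, (1 - nn H (A v) c / ((A v).card + 1))) := by
  induction N using Finset.induction_on with
  | empty =>
    intro s hs0 hs1
    have : indSets H A ∅ = {∅} := by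
      ext I; rw [mem_indSets]
      simp only [Finset.biUnion_empty, Finset.subset_empty, Finset.mem_singleton]
      constructor
      · exact fun h => h.2
      · rintro rfl; exact ⟨by intro a ha; simp at ha, rfl⟩
    simp [this, surv]
  | insert v N hv ih =>
    intro s hs0 hs1
    rw [sum_indSets_insert hv hg, card_indSets_insert hv hg]
    have hpos : (0:ℝ) < (A v).card + 1 := by positivity
    have hq0 : ∀ c, 0 ≤ 1 - nn H (A v) c / ((A v).card + 1) := by
      intro c
      have := nn_le H (A v) c
      rw [sub_nonneg, div_le_one hpos]; linarith
    have hq1 : ∀ c, 1 - nn H (A v) c / ((A v).card + 1) ≤ 1 := by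
      intro c
      have := div_nonneg (nn_nonneg H (A v) c) hpos.le
      linarith
    have ih' := ih (hg.mono (Finset.subset_insert v N)) (fun w hw => hm w (by simp [hw]))
      (fun c => s c * (1 - nn H (A v) c / ((A v).card + 1)))
      (fun c => mul_nonneg (hs0 c) (hq0 c)) (fun c => mul_le_one₀ (hs1 c) (hq0 c) (hq1 c))
    have h1 : ∀ I ∈ indSets H A N,
        (∏ c ∈ C, (1 - s c * surv H I c) +
          ∑ d ∈ A v, ∏ c ∈ C, (1 - s c * surv H (insert d I) c)) ≤
        ((A v).card + 1) *
          ∏ c ∈ C, (1 - s c * (1 - nn H (A v) c / ((A v).card + 1)) * surv H I c) := by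
      intro I _
      have := one_step H (A v) C (hm v (by simp)) (fun c => s c * surv H I c)
        (fun c => mul_nonneg (hs0 c) (surv_nonneg H I c))
        (fun c => mul_le_one₀ (hs1 c) (surv_nonneg H I c) (surv_le_one H I c))
      simp only [surv_insert, ← mul_assoc]
      refine this.trans (le_of_eq ?_)
      congr 1
      exact Finset.prod_congr rfl fun c _ => by ring
    refine (Finset.sum_le_sum h1).trans ?_
    rw [← Finset.mul_sum]
    refine (mul_le_mul_of_nonneg_left ih' hpos.le).trans (le_of_eq ?_)
    have h2 : ∀ c, s c * ∏ w ∈ insert v N, (1 - nn H (A w) c / ((A w).card + 1)) =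
        s c * (1 - nn H (A v) c / ((A v).card + 1)) *
          ∏ w ∈ N, (1 - nn H (A w) c / ((A w).card + 1)) := by
      intro c; rw [Finset.prod_insert hv]; ring
    simp only [h2]; ring

/-- number of blank vertices seen by `c` -/
noncomputable def blanks {V U : Type} (H : SimpleGraph U) (A : V → Finset U) (N : Finset V)
    (I : Finset U) (c : U) : Finset V :=
  N.filter fun v => (∃ d ∈ A v, H.Adj c d) ∧ ∀ d ∈ A v, d ∉ I

theorem blank_bound {V U : Type} [Fintype U] [DecidableEq U]
    {H : SimpleGraph U} {A : V → Finset U} (c : U) (N : Finset V) (hg : GoodLists H A N) :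
    ∑ I ∈ indSets H A N, surv H I c * 2 ^ (blanks H A N I c).card ≤ (indSets H A N).card := by
  induction N using Finset.induction_on with
  | empty =>
    calc _ ≤ ∑ I ∈ indSets H A ∅, (1:ℝ) :=
          Finset.sum_le_sum fun I _ => by simpa [blanks] using surv_le_one H I c
      _ = _ := by simp
  | insert v N hv ih =>
    rw [sum_indSets_insert hv hg, card_indSets_insert hv hg]
    have ih' := ih (hg.mono (Finset.subset_insert v N))
    have hpos : (0:ℝ) < (A v).card + 1 := by positivity
    refine le_trans (Finset.sum_le_sum (g := fun I =>
      ((A v).card + 1) * (surv H I c * 2 ^ (blanks H A N I c).card)) ?_) ?_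
    · intro I hI
      have hb1 : ∀ d ∈ A v, blanks H A (insert v N) (insert d I) c = blanks H A N I c := by
        intro d hd
        ext w
        simp only [blanks, Finset.mem_filter, Finset.mem_insert]
        constructor
        · rintro ⟨hw, h1, h2⟩
          rcases hw with rfl | hw
          · exact absurd (Or.inl rfl) (h2 d hd)
          · exact ⟨hw, h1, fun x hx hxI => h2 x hx (Or.inr hxI)⟩
        · rintro ⟨hw, h1, h2⟩
          refine ⟨Or.inr hw, h1, fun x hx hxI => ?_⟩
          rcases hxI with rfl | hxI
          · exact hg.2.1 v (by simp) w (by simp [hw]) (by rintro rfl; exact hv hw) x hd hx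
          · exact h2 x hx hxI
      have hb2 : surv H I c * (2:ℝ) ^ (blanks H A (insert v N) I c).card =
          (surv H I c * 2 ^ (blanks H A N I c).card) *
          (if ∃ d ∈ A v, H.Adj c d then 2 else 1) := by
        have hnot : ∀ d ∈ A v, d ∉ I := fun d hd => indSets_not_mem hv hg hI hd
        unfold blanks
        rw [Finset.filter_insert]
        by_cases h : ∃ d ∈ A v, H.Adj c d
        · rw [if_pos ⟨h, hnot⟩, if_pos h, Finset.card_insert_of_notMem (by simp [hv]), pow_succ]
          ring
        · rw [if_neg (fun hh => h hh.1), if_neg h, mul_one]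
      have hs : ∑ d ∈ A v, surv H (insert d I) c *
          2 ^ (blanks H A (insert v N) (insert d I) c).card =
          (surv H I c * 2 ^ (blanks H A N I c).card) * ∑ d ∈ A v, (if H.Adj c d then 0 else 1) := by
        rw [Finset.mul_sum]
        refine Finset.sum_congr rfl fun d hd => ?_
        rw [hb1 d hd, surv_insert]; ring
      rw [hb2, hs, ← mul_add, mul_comm]
      refine mul_le_mul_of_nonneg_right ?_ (mul_nonneg (surv_nonneg H I c) (by positivity))
      by_cases h : ∃ d ∈ A v, H.Adj c d
      · rw [if_pos h]
        obtain ⟨d, hd, hcd⟩ := h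
        rw [← Finset.add_sum_erase _ _ hd, if_pos hcd]
        have : ∑ x ∈ (A v).erase d, (if H.Adj c x then (0:ℝ) else 1) ≤
            ∑ x ∈ (A v).erase d, (1:ℝ) :=
          Finset.sum_le_sum fun x _ => by split_ifs <;> norm_num
        have h3 : (((A v).erase d).card : ℝ) + 1 = (A v).card := by
          exact_mod_cast Finset.card_erase_add_one hd
        simp only [Finset.sum_const, nsmul_eq_mul, mul_one] at this
        linarith
      · rw [if_neg h]
        have : ∑ x ∈ A v, (if H.Adj c x then (0:ℝ) else 1) ≤ ∑ x ∈ A v, (1:ℝ) :=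
          Finset.sum_le_sum fun x _ => by split_ifs <;> norm_num
        simp only [Finset.sum_const, nsmul_eq_mul, mul_one] at this
        linarith
    · rw [← Finset.mul_sum, mul_comm ((indSets H A N).card : ℝ)]
      exact mul_le_mul_of_nonneg_left ih' hpos.le

theorem indSets_card_pos {V U : Type} [Fintype U] [DecidableEq U]
    (H : SimpleGraph U) (A : V → Finset U) (N : Finset V) :
    (0:ℝ) < (indSets H A N).card := by
  have : (∅ : Finset U) ∈ indSets H A N := mem_indSets.2 ⟨by intro a ha; simp at ha, by simp⟩
  exact_mod_cast Finset.card_pos.2 ⟨_, this⟩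

/-- Lower bound on the expectation. -/
theorem expect_lower {V U : Type} {H : SimpleGraph U} {A : V → Finset U} (C : Finset U)
    (N : Finset V) (hC : 0 < C.card)
    (hm : ∀ v ∈ N, ∀ d ∈ A v, ∀ c ∈ C, ∀ c' ∈ C, H.Adj c d → H.Adj c' d → c = c')
    (hm' : ∀ v ∈ N, ∀ c ∈ C, ∀ d ∈ A v, ∀ d' ∈ A v, H.Adj c d → H.Adj c d' → d = d') :
    (C.card : ℝ) * Real.exp (-(N.card / C.card)) ≤
      ∑ c ∈ C, ∏ v ∈ N, (1 - nn H (A v) c / ((A v).card + 1)) := by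
  have hk : (0:ℝ) < C.card := by exact_mod_cast hC
  have hn1 : ∀ v ∈ N, ∀ c ∈ C, nn H (A v) c ≤ 1 := by
    intro v hv c hc
    unfold nn
    by_cases h : ∃ d ∈ A v, H.Adj c d
    · obtain ⟨d, hd, hcd⟩ := h
      rw [Finset.sum_eq_single_of_mem d hd]
      · simp [hcd]
      · intro x hx hxd
        rw [if_neg]
        exact fun hcx => hxd (hm' v hv c hc x hx d hd hcx hcd)
    · push Not at h
      rw [Finset.sum_eq_zero fun x hx => by simp [h x hx]]
      norm_num
  have h1 : ∀ c ∈ C, Real.exp (-∑ v ∈ N, nn H (A v) c / (A v).card) ≤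
      ∏ v ∈ N, (1 - nn H (A v) c / ((A v).card + 1)) := by
    intro c hc
    rw [← Finset.sum_neg_distrib, Real.exp_sum]
    refine Finset.prod_le_prod (fun _ _ => (Real.exp_pos _).le) fun v hv => ?_
    have a0 := nn_nonneg H (A v) c
    have a1 := hn1 v hv c hc
    have a2 := nn_le H (A v) c
    rcases (Nat.eq_zero_or_pos (A v).card) with h | h
    · have : nn H (A v) c = 0 := by
        rw [h] at a2; push_cast at a2; linarith
      simp [this]
    · have hp : (0:ℝ) < (A v).card := by exact_mod_cast h
      set a : ℝ := ((A v).card : ℝ)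
      set n := nn H (A v) c
      have e1 : Real.exp (-(n / a)) ≤ 1 / (1 + n / a) := by
        rw [Real.exp_neg, ← one_div]
        apply one_div_le_one_div_of_le
        · positivity
        · linarith [Real.add_one_le_exp (n / a)]
      refine e1.trans ?_
      have : 1 / (1 + n / a) = a / (a + n) := by field_simp
      rw [this]
      have h4 : 1 - n / (a + 1) = (a + 1 - n) / (a + 1) := by field_simp
      rw [h4, div_le_div_iff₀ (by positivity) (by positivity)]
      nlinarith
  have h2 : ∑ c ∈ C, ∑ v ∈ N, nn H (A v) c / (A v).card ≤ N.card := by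
    rw [Finset.sum_comm]
    calc _ ≤ ∑ v ∈ N, (1:ℝ) := by
          refine Finset.sum_le_sum fun v hv => ?_
          rw [← Finset.sum_div]
          apply div_le_one_of_le₀ _ (by positivity)
          unfold nn
          rw [Finset.sum_comm]
          calc _ ≤ ∑ d ∈ A v, (1:ℝ) := by
                refine Finset.sum_le_sum fun d hd => ?_
                by_cases h : ∃ c ∈ C, H.Adj c d
                · obtain ⟨c, hc, hcd⟩ := h
                  rw [Finset.sum_eq_single_of_mem c hc]
                  · simp [hcd]
                  · intro x hx hxc
                    rw [if_neg]
                    exact fun hxd => hxc (hm v hv d hd x hx c hc hxd hcd)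
                · push Not at h
                  rw [Finset.sum_eq_zero fun x hx => by simp [h x hx]]
                  norm_num
            _ = _ := by simp
      _ = _ := by simp
  refine le_trans ?_ (Finset.sum_le_sum h1)
  set m : ℝ := N.card / C.card with hmdef
  have hkm : C.card * m = N.card := by rw [hmdef]; field_simp
  have h3 : ∀ t : ℝ, Real.exp (-m) * (1 + m - t) ≤ Real.exp (-t) := by
    intro t
    have := Real.add_one_le_exp (m - t)
    calc _ ≤ Real.exp (-m) * Real.exp (m - t) :=
          mul_le_mul_of_nonneg_left (by linarith) (Real.exp_pos _).le
      _ = _ := by rw [← Real.exp_add]; congr 1; ring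
  calc (C.card : ℝ) * Real.exp (-m)
      ≤ Real.exp (-m) * (C.card * (1 + m) - ∑ c ∈ C, ∑ v ∈ N, nn H (A v) c / (A v).card) := by
        rw [mul_comm]
        refine mul_le_mul_of_nonneg_left ?_ (Real.exp_pos _).le
        linarith
    _ = ∑ c ∈ C, Real.exp (-m) * (1 + m - ∑ v ∈ N, nn H (A v) c / (A v).card) := by
        rw [← Finset.mul_sum, Finset.sum_sub_distrib, Finset.sum_const, nsmul_eq_mul]
    _ ≤ _ := Finset.sum_le_sum fun c _ => h3 _

/-- Lower tail bound. -/
theorem lower_tail {V U : Type} [Fintype U] [DecidableEq U]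
    {H : SimpleGraph U} {A : V → Finset U} (C : Finset U) (N : Finset V)
    (hg : GoodLists H A N)
    (hm : ∀ v ∈ N, ∀ d ∈ A v, ∀ c ∈ C, ∀ c' ∈ C, H.Adj c d → H.Adj c' d → c = c')
    (ℓ : ℝ)
    (hE : 2 * ℓ ≤ ∑ c ∈ C, ∏ v ∈ N, (1 - nn H (A v) c / ((A v).card + 1)))
    (B : Finset (Finset U)) (hB : B ⊆ indSets H A N)
    (hB' : ∀ I ∈ B, ((C.filter fun c => ∀ d ∈ I, ¬ H.Adj c d).card : ℝ) ≤ ℓ) :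
    (B.card : ℝ) ≤ (indSets H A N).card * Real.exp (-(ℓ * (1 - Real.log 2))) := by
  have h1 := neg_corr C N hg hm (fun _ => 1/2) (fun _ => by norm_num) (fun _ => by norm_num)
  have h2 : ∏ c ∈ C, (1 - 1/2 * ∏ v ∈ N, (1 - nn H (A v) c / ((A v).card + 1))) ≤
      Real.exp (-ℓ) := by
    have hP : ∀ c, 0 ≤ ∏ v ∈ N, (1 - nn H (A v) c / ((A v).card + 1)) ∧
        ∏ v ∈ N, (1 - nn H (A v) c / ((A v).card + 1)) ≤ 1 := by
      intro c
      have h0 : ∀ v ∈ N, 0 ≤ 1 - nn H (A v) c / ((A v).card + 1) := by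
        intro v _
        have := nn_le H (A v) c
        rw [sub_nonneg, div_le_one (by positivity)]; linarith
      refine ⟨Finset.prod_nonneg h0, Finset.prod_le_one h0 fun v _ => ?_⟩
      have : 0 ≤ nn H (A v) c / ((A v).card + 1) :=
        div_nonneg (nn_nonneg H (A v) c) (by positivity)
      linarith
    calc _ ≤ ∏ c ∈ C, Real.exp (-(1/2 * ∏ v ∈ N, (1 - nn H (A v) c / ((A v).card + 1)))) := by
          refine Finset.prod_le_prod (fun c _ => by linarith [(hP c).1, (hP c).2]) fun c _ => ?_
          linarith [Real.add_one_le_exp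
            (-(1/2 * ∏ v ∈ N, (1 - nn H (A v) c / ((A v).card + 1))))]
      _ = Real.exp (-(1/2 * ∑ c ∈ C, ∏ v ∈ N, (1 - nn H (A v) c / ((A v).card + 1)))) := by
          rw [← Real.exp_sum, Finset.sum_neg_distrib, Finset.mul_sum]
      _ ≤ _ := Real.exp_le_exp.2 (by linarith)
  have hnn : ∀ I, 0 ≤ ∏ c ∈ C, (1 - 1/2 * surv H I c) := fun I =>
    Finset.prod_nonneg fun c _ => by linarith [surv_le_one H I c]
  have h3 : (B.card : ℝ) * Real.exp (-(ℓ * Real.log 2)) ≤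
      ∑ I ∈ indSets H A N, ∏ c ∈ C, (1 - 1/2 * surv H I c) := by
    refine le_trans ?_ (Finset.sum_le_sum_of_subset_of_nonneg hB fun I _ _ => hnn I)
    rw [← nsmul_eq_mul]
    refine Finset.card_nsmul_le_sum _ _ _ fun I hI => ?_
    have : ∏ c ∈ C, (1 - 1/2 * surv H I c) =
        Real.exp (-(((C.filter fun c => ∀ d ∈ I, ¬ H.Adj c d).card : ℝ) * Real.log 2)) := by
      rw [Finset.card_filter]
      push_cast
      rw [Finset.sum_mul, ← Finset.sum_neg_distrib, Real.exp_sum]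
      refine Finset.prod_congr rfl fun c _ => ?_
      unfold surv
      split_ifs
      · rw [one_mul, Real.exp_neg, Real.exp_log (by norm_num)]; norm_num
      · simp
    rw [this]
    apply Real.exp_le_exp.2
    have := mul_le_mul_of_nonneg_right (hB' I hI) (Real.log_nonneg (by norm_num : (1:ℝ) ≤ 2))
    linarith
  have h4 := h3.trans (h1.trans (mul_le_mul_of_nonneg_left h2 (by positivity)))
  have h5 : Real.exp (-(ℓ * (1 - Real.log 2))) =
      Real.exp (-ℓ) * Real.exp (ℓ * Real.log 2) := by
    rw [← Real.exp_add]; congr 1; ring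
  have h6 : Real.exp (-(ℓ * Real.log 2)) * Real.exp (ℓ * Real.log 2) = 1 := by
    rw [← Real.exp_add]; simp
  rw [h5]
  calc (B.card : ℝ) = B.card * Real.exp (-(ℓ * Real.log 2)) * Real.exp (ℓ * Real.log 2) := by
        rw [mul_assoc, h6, mul_one]
    _ ≤ _ := by
        rw [← mul_assoc]
        exact mul_le_mul_of_nonneg_right h4 (Real.exp_pos _).le

/-- Upper tail bound on the blank count. -/
theorem upper_tail {V U : Type} [Fintype U] [DecidableEq U]
    {H : SimpleGraph U} {A : V → Finset U} (C : Finset U) (N : Finset V)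
    (hg : GoodLists H A N) (t : ℝ)
    (B : Finset (Finset U)) (hB : B ⊆ indSets H A N)
    (hB' : ∀ I ∈ B, ∃ c ∈ C, (∀ d ∈ I, ¬ H.Adj c d) ∧ t ≤ (blanks H A N I c).card) :
    (B.card : ℝ) ≤ (indSets H A N).card * (C.card * Real.exp (-(t * Real.log 2))) := by
  have hnn : ∀ I c, 0 ≤ surv H I c * 2 ^ (blanks H A N I c).card := fun I c =>
    mul_nonneg (surv_nonneg H I c) (by positivity)
  have h1 : (B.card : ℝ) * Real.exp (t * Real.log 2) ≤
      ∑ I ∈ indSets H A N, ∑ c ∈ C, surv H I c * 2 ^ (blanks H A N I c).card := by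
    refine le_trans ?_ (Finset.sum_le_sum_of_subset_of_nonneg hB fun I _ _ =>
      Finset.sum_nonneg fun c _ => hnn I c)
    rw [← nsmul_eq_mul]
    refine Finset.card_nsmul_le_sum _ _ _ fun I hI => ?_
    obtain ⟨c, hc, hs, ht⟩ := hB' I hI
    refine le_trans ?_ (Finset.single_le_sum (fun c _ => hnn I c) hc)
    have : surv H I c = 1 := by unfold surv; rw [if_pos hs]
    rw [this, one_mul]
    calc _ ≤ Real.exp ((blanks H A N I c).card * Real.log 2) :=
          Real.exp_le_exp.2 (mul_le_mul_of_nonneg_right ht (Real.log_nonneg (by norm_num)))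
      _ = _ := by rw [Real.exp_nat_mul, Real.exp_log (by norm_num)]
  rw [Finset.sum_comm] at h1
  have h2 : ∑ c ∈ C, ∑ I ∈ indSets H A N, surv H I c * 2 ^ (blanks H A N I c).card ≤
      C.card * (indSets H A N).card := by
    rw [← nsmul_eq_mul]
    exact Finset.sum_le_card_nsmul _ _ _ fun c _ => blank_bound c N hg
  have h3 := h1.trans h2
  rw [Real.exp_neg, ← div_eq_mul_inv, mul_div_assoc', le_div_iff₀ (Real.exp_pos _)]
  linarith

theorem numerics (ε : ℝ) (hε₀ : 0 < ε) (hε₁ : ε < 1) :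
    ∃ Δ₀ : ℕ, ∀ Δ : ℕ, Δ₀ ≤ Δ →
      (8 : ℝ) ≤ Δ ∧ 1 ≤ Real.log Δ ∧
      Real.exp 1 ≤ (192 * Real.log Δ) ^ (2 / ε) ∧
      (192 * Real.log Δ) ^ (2 / ε) ≤ Δ ∧
      ∀ D : ℝ, (192 * Real.log Δ) ^ (2 / ε) ≤ D →
        2 * D ^ (ε / 2) ≤ (1 + ε) * (D / Real.log D) * Real.exp (-(Real.log D / (1 + ε))) := by
  have hp : 0 < 2 / ε := by positivity
  have hs : 0 < ε / (1 + ε) - ε / 2 := by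
    rw [sub_pos, div_lt_div_iff₀ (by norm_num) (by linarith)]
    nlinarith
  have e1 : ∀ᶠ D : ℝ in Filter.atTop,
      Real.log D ≤ (1 + ε) / 2 * D ^ (ε / (1 + ε) - ε / 2) := by
    have := (isLittleO_log_rpow_atTop hs).bound (show 0 < (1 + ε) / 2 by linarith)
    filter_upwards [this, Filter.eventually_ge_atTop 1] with D h h1
    rw [Real.norm_of_nonneg (Real.log_nonneg h1),
      Real.norm_of_nonneg (Real.rpow_nonneg (by linarith) _)] at h
    exact h
  obtain ⟨D₁, hD₁⟩ := Filter.eventually_atTop.1 e1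
  have t1 : Filter.Tendsto (fun Δ : ℕ => (Δ : ℝ)) Filter.atTop Filter.atTop :=
    tendsto_natCast_atTop_atTop
  have t2 := Real.tendsto_log_atTop.comp t1
  have t3 : Filter.Tendsto (fun Δ : ℕ => (192 * Real.log (Δ : ℝ)) ^ (2 / ε))
      Filter.atTop Filter.atTop :=
    (tendsto_rpow_atTop hp).comp (t2.const_mul_atTop (by norm_num : (0:ℝ) < 192))
  have e2 : ∀ᶠ Δ : ℕ in Filter.atTop, (192 * Real.log (Δ : ℝ)) ^ (2 / ε) ≤ Δ := by
    have h192 : (0:ℝ) < 192 ^ (2 / ε) := Real.rpow_pos_of_pos (by norm_num) _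
    have := (isLittleO_log_rpow_rpow_atTop (2 / ε) (zero_lt_one)).bound (inv_pos.2 h192)
    filter_upwards [t1.eventually this, t1.eventually_ge_atTop 1] with Δ h h1
    have hl := Real.log_nonneg h1
    rw [Real.norm_of_nonneg (Real.rpow_nonneg hl _),
      Real.norm_of_nonneg (Real.rpow_nonneg (by linarith) _), Real.rpow_one] at h
    rw [Real.mul_rpow (by norm_num) hl]
    rw [inv_mul_eq_div, le_div_iff₀ h192] at h
    linarith
  apply Filter.eventually_atTop.1
  filter_upwards [t1.eventually_ge_atTop 8, t2.eventually_ge_atTop 1,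
    t3.eventually_ge_atTop (Real.exp 1), e2, t3.eventually_ge_atTop D₁] with Δ h1 h2 h3 h4 h5
  refine ⟨h1, h2, h3, h4, fun D hD => ?_⟩
  have hDe : Real.exp 1 ≤ D := h3.trans hD
  have hD0 : 0 < D := (Real.exp_pos 1).trans_le hDe
  have hlog : 1 ≤ Real.log D := by rwa [Real.le_log_iff_exp_le hD0]
  have h6 := hD₁ D (h5.trans hD)
  have h7 : Real.exp (-(Real.log D / (1 + ε))) = D ^ (-(1 / (1 + ε))) := by
    rw [Real.rpow_def_of_pos hD0]; congr 1; ring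
  rw [h7]
  have h8 : D * D ^ (-(1 / (1 + ε))) = D ^ (ε / 2) * D ^ (ε / (1 + ε) - ε / 2) := by
    rw [← Real.rpow_add hD0]
    nth_rewrite 1 [← Real.rpow_one D]
    rw [← Real.rpow_add hD0]
    congr 1
    field_simp
    ring
  have h9 : (1 + ε) * (D / Real.log D) * D ^ (-(1 / (1 + ε))) =
      (1 + ε) * (D * D ^ (-(1 / (1 + ε)))) / Real.log D := by ring
  rw [h9, h8, le_div_iff₀ (by linarith)]
  have h10 : 0 < D ^ (ε / 2) := Real.rpow_pos_of_pos hD0 _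
  nlinarith [mul_le_mul_of_nonneg_left h6 h10.le]

/-- Lemma 10 of the paper (analogue of Bernshteyn's Lemma 3.6): in the setting of the
local Molloy theorem, fix a vertex `u` and an independent set `J` of `H` contained in
the lists of vertices outside `N_G[u]`. For a uniformly random independent set `𝐈'` of
`H` contained in `⋃_{v ∈ N_G(u)} L_J(v)`, setting `𝐈 = J ∪ 𝐈'`:
(1) `Pr(|L_𝐈(u)| < ℓ(u)) ≤ Δ⁻³/8`, and
(2) `Pr(∃ c ∈ L_𝐈(u), deg*_{ℋ_𝐈}(c) > 24 log Δ) ≤ Δ⁻³/8`. -/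
theorem random_partial_colouring_step (ε : ℝ) (hε₀ : 0 < ε) (hε₁ : ε < 1) :
    ∃ Δ₀ : ℕ, ∀ Δ : ℕ, Δ₀ ≤ Δ →
      ∀ (V U : Type) [Fintype V] [Fintype U] [DecidableEq U]
        (G : SimpleGraph V) [DecidableRel G.Adj] (H : SimpleGraph U) [DecidableRel H.Adj]
        (L : V → Finset U),
        G.CliqueFree 3 →
        (∀ v : V, G.degree v ≤ Δ) →
        IsCover G H L →
        (∀ w : V, (L w).card =
          ⌈(1 + ε) * max ((G.degree w : ℝ) / Real.log (G.degree w))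
              (((192 * Real.log Δ) ^ (2 / ε)) /
                Real.log ((192 * Real.log Δ) ^ (2 / ε)))⌉₊) →
        ∀ (u : V) (J : Finset U),
          IndepFinset H J →
          (∀ c ∈ J, ∀ v : V, c ∈ L v → v ∉ insert u (G.neighborFinset u)) →
          (((Finset.univ.filter fun I' : Finset U =>
                (IndepFinset H I' ∧
                  I' ⊆ (G.neighborFinset u).biUnion fun v => coverLI H L J v) ∧
                ((coverLI H L (J ∪ I') u).card : ℝ) <
                  max ((G.degree u : ℝ) ^ (ε / 2))
                    (((192 * Real.log Δ) ^ (2 / ε)) ^ (ε / 2))).card : ℝ) /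
              ((Finset.univ.filter fun I' : Finset U =>
                IndepFinset H I' ∧
                  I' ⊆ (G.neighborFinset u).biUnion fun v => coverLI H L J v).card : ℝ) ≤
            1 / (8 * (Δ : ℝ) ^ 3)) ∧
          (((Finset.univ.filter fun I' : Finset U =>
                (IndepFinset H I' ∧
                  I' ⊆ (G.neighborFinset u).biUnion fun v => coverLI H L J v) ∧
                ∃ c ∈ coverLI H L (J ∪ I') u,
                  24 * Real.log Δ < (degStarI H L (J ∪ I') c : ℝ)).card : ℝ) /
              ((Finset.univ.filter fun I' : Finset U =>
                IndepFinset H I' ∧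
                  I' ⊆ (G.neighborFinset u).biUnion fun v => coverLI H L J v).card : ℝ) ≤
            1 / (8 * (Δ : ℝ) ^ 3)) := by
  obtain ⟨Δ₀, hΔ₀⟩ := numerics ε hε₀ hε₁
  refine ⟨Δ₀, fun Δ hΔ => ?_⟩
  obtain ⟨hΔ8, hlg, hδe, hδΔ, hD⟩ := hΔ₀ Δ hΔ
  clear hΔ₀
  intro V U _ _ _ G _ H _ L hG hdeg hcov hL u J hJ hJu
  obtain ⟨hpart, hclq, hedge, hmat⟩ := hcov
  set δ : ℝ := (192 * Real.log Δ) ^ (2 / ε) with hδ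
  have hδ0 : 0 < δ := (Real.exp_pos 1).trans_le hδe
  have hlogδ : 1 ≤ Real.log δ := by rwa [Real.le_log_iff_exp_le hδ0]
  have hΔpos : (0:ℝ) < Δ := by linarith
  have hδε : δ ^ (ε / 2) = 192 * Real.log Δ := by
    rw [hδ, ← Real.rpow_mul (by linarith)]
    have : 2 / ε * (ε / 2) = 1 := by field_simp
    rw [this, Real.rpow_one]
  set A : V → Finset U := fun v => coverLI H L J v with hA
  set N := G.neighborFinset u with hN
  have hAL : ∀ v, A v ⊆ L v := fun v => Finset.sdiff_subset
  have hadj : ∀ v, v ∈ N ↔ G.Adj u v := fun v => by simp [hN]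
  have hg : GoodLists H A N := by
    refine ⟨fun v _ c hc d hd => hclq v c (hAL v hc) d (hAL v hd), ?_, ?_⟩
    · intro v _ w _ hvw c hc hc'
      exact hvw ((hpart c).unique (hAL v hc) (hAL w hc'))
    · intro v hv w hw hvw c hc d hd hcd
      rcases hedge c d hcd v w (hAL v hc) (hAL w hd) with h | h
      · exact hvw h
      · exact hG {u, v, w} (SimpleGraph.is3Clique_triple_iff.2 ⟨(hadj v).1 hv, (hadj w).1 hw, h⟩)
  have hm : ∀ v ∈ N, ∀ d ∈ A v, ∀ c ∈ L u, ∀ c' ∈ L u, H.Adj c d → H.Adj c' d → c = c' := by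
    intro v hv d hd c hc c' hc' h h'
    exact hmat v u ((hadj v).1 hv).symm d (hAL v hd) c hc c' hc' h.symm h'.symm
  have hm' : ∀ v ∈ N, ∀ c ∈ L u, ∀ d ∈ A v, ∀ d' ∈ A v, H.Adj c d → H.Adj c d' → d = d' := by
    intro v hv c hc d hd d' hd' h h'
    exact hmat u v ((hadj v).1 hv) c hc d (hAL v hd) d' (hAL v hd') h h'
  have hJno : ∀ c ∈ L u, ∀ x ∈ J, ¬ H.Adj x c := by
    intro c hc x hx hxc
    obtain ⟨w, hw, _⟩ := hpart x
    have h1 := hJu x hx w hw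
    rw [Finset.mem_insert, not_or] at h1
    rcases hedge x c hxc w u hw hc with h | h
    · exact h1.1 h
    · exact h1.2 ((hadj w).2 h.symm)
  have hLI : ∀ I', coverLI H L (J ∪ I') u = (L u).filter fun c => ∀ d ∈ I', ¬ H.Adj c d := by
    intro I'
    ext c
    simp only [coverLI, Finset.mem_sdiff, Finset.mem_biUnion, Finset.mem_union,
      SimpleGraph.mem_neighborFinset, Finset.mem_filter]
    constructor
    · rintro ⟨h1, h2⟩
      exact ⟨h1, fun d hd hcd => h2 ⟨d, Or.inr hd, hcd.symm⟩⟩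
    · rintro ⟨h1, h2⟩
      refine ⟨h1, ?_⟩
      rintro ⟨d, hd | hd, hdc⟩
      · exact hJno c h1 d hd hdc
      · exact h2 d hd hdc.symm
  have hS : ∀ I' : Finset U, (IndepFinset H I' ∧ I' ⊆ N.biUnion A) ↔ I' ∈ indSets H A N :=
    fun I' => mem_indSets.symm
  have hSeq : (Finset.univ.filter fun I' : Finset U =>
      IndepFinset H I' ∧ I' ⊆ N.biUnion A) = indSets H A N := by
    ext I'; simp [mem_indSets]
  have hSpos := indSets_card_pos H A N
  rw [hSeq]
  have h8 : Real.exp (-(4 * Real.log Δ)) ≤ 1 / (8 * (Δ : ℝ) ^ 3) := by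
    have : Real.exp (4 * Real.log Δ) = (Δ : ℝ) ^ 4 := by
      have := Real.exp_nat_mul (Real.log Δ) 4
      rw [Real.exp_log hΔpos] at this
      exact_mod_cast this
    rw [Real.exp_neg, this, ← one_div]
    apply one_div_le_one_div_of_le (by positivity)
    nlinarith [pow_pos hΔpos 3]
  have hdegN : (N.card : ℝ) = G.degree u := by rw [hN, SimpleGraph.card_neighborFinset_eq_degree]
  constructor
  · rw [div_le_iff₀ hSpos]
    set D : ℝ := max (G.degree u : ℝ) δ with hDdef
    have hDδ : δ ≤ D := le_max_right _ _
    have hD0 : 0 < D := hδ0.trans_le hDδ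
    have hlogD : 1 ≤ Real.log D := by
      rw [Real.le_log_iff_exp_le hD0]; exact hδe.trans hDδ
    have hell : max ((G.degree u : ℝ) ^ (ε / 2)) (δ ^ (ε / 2)) ≤ D ^ (ε / 2) :=
      max_le (Real.rpow_le_rpow (by positivity) (le_max_left _ _) (by positivity))
        (Real.rpow_le_rpow hδ0.le hDδ (by positivity))
    have hk : (1 + ε) * (D / Real.log D) ≤ (L u).card := by
      rw [hL u]
      refine le_trans ?_ (Nat.le_ceil _)
      refine mul_le_mul_of_nonneg_left ?_ (by linarith)
      rcases le_total (G.degree u : ℝ) δ with h | h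
      · rw [hDdef, max_eq_right h]; exact le_max_right _ _
      · rw [hDdef, max_eq_left h]; exact le_max_left _ _
    have hk0 : (0:ℝ) < (1 + ε) * (D / Real.log D) := by positivity
    have hkpos : (0:ℝ) < (L u).card := hk0.trans_le hk
    have hE := expect_lower (H := H) (A := A) (L u) N (by exact_mod_cast hkpos) hm hm'
    have hE2 : 2 * D ^ (ε / 2) ≤ (L u).card * Real.exp (-(N.card / (L u).card)) := by
      refine (hD D hDδ).trans ?_
      refine mul_le_mul hk ?_ (Real.exp_pos _).le hkpos.le
      apply Real.exp_le_exp.2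
      apply neg_le_neg
      rw [div_le_div_iff₀ hkpos (by linarith), hdegN]
      have h1 : (G.degree u : ℝ) ≤ D := le_max_left _ _
      have h2 : D * (1 + ε) ≤ Real.log D * (L u).card := by
        have := mul_le_mul_of_nonneg_left hk (by linarith : 0 ≤ Real.log D)
        refine le_trans (le_of_eq ?_) this
        field_simp
      exact (mul_le_mul_of_nonneg_right h1 (by linarith)).trans h2
    refine (lower_tail (L u) N hg hm (D ^ (ε / 2)) (hE2.trans hE) _ ?_ ?_).trans ?_
    · intro I hI
      rw [Finset.mem_filter] at hI
      exact (hS I).1 hI.2.1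
    · intro I hI
      rw [Finset.mem_filter, hLI] at hI
      refine le_trans ?_ (hI.2.2.le.trans hell)
      apply le_of_eq
      congr!
    · rw [mul_comm]
      refine mul_le_mul_of_nonneg_right (le_trans (Real.exp_le_exp.2 ?_) h8) hSpos.le
      have h1 : 192 * Real.log Δ ≤ D ^ (ε / 2) := by
        rw [← hδε]; exact Real.rpow_le_rpow hδ0.le hDδ (by positivity)
      have h2 := Real.log_two_lt_d9
      nlinarith
  · rw [div_le_iff₀ hSpos]
    refine (upper_tail (L u) N hg (24 * Real.log Δ) _ ?_ ?_).trans ?_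
    · intro I hI
      rw [Finset.mem_filter] at hI
      exact (hS I).1 hI.2.1
    · intro I hI
      rw [Finset.mem_filter] at hI
      obtain ⟨_, _, c, hc, hlt⟩ := hI
      rw [hLI, Finset.mem_filter] at hc
      refine ⟨c, hc.1, hc.2, hlt.le.trans ?_⟩
      have hcu := hc.1
      choose part hpm hpu using hpart
      unfold degStarI
      norm_cast
      have hprop : ∀ d, (H.Adj c d ∧ d ∉ closedNbhd H (J ∪ I) ∧ ∀ u : V, c ∈ L u → d ∉ L u) →
          G.Adj u (part d) ∧ d ∈ A (part d) ∧ ∀ e ∈ A (part d), e ∉ I := by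
        rintro d ⟨h1, h2, h3⟩
        simp only [closedNbhd, Finset.mem_union, Finset.mem_biUnion,
          SimpleGraph.mem_neighborFinset, not_or, not_exists, not_and] at h2
        have hdp : d ∈ L (part d) := hpm d
        refine ⟨?_, ?_, ?_⟩
        · rcases hedge c d h1 u (part d) hcu hdp with h | h
          · exact absurd (h ▸ hdp) (h3 u hcu)
          · exact h
        · simp only [hA, coverLI, Finset.mem_sdiff, Finset.mem_biUnion,
            SimpleGraph.mem_neighborFinset, not_exists, not_and]
          exact ⟨hdp, fun x hx => h2.2 x (Or.inl hx)⟩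
        · intro e he heI
          have hed : e ≠ d := by rintro rfl; exact h2.1.2 heI
          exact h2.2 e (Or.inr heI) (hclq _ e (hAL _ he) d hdp hed)
      refine Finset.card_le_card_of_injOn part ?_ ?_
      · intro d hd
        simp only [Finset.coe_filter, Finset.mem_univ, true_and, Set.mem_setOf_eq] at hd
        obtain ⟨h1, h2, h3⟩ := hprop d hd
        simp only [blanks, Finset.coe_filter, Set.mem_setOf_eq]
        exact ⟨(hadj _).2 h1, ⟨d, h2, hd.1⟩, h3⟩
      · intro d hd d' hd' heq
        simp only [Finset.coe_filter, Finset.mem_univ, true_and, Set.mem_setOf_eq] at hd hd'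
        obtain ⟨h1, h2, _⟩ := hprop d hd
        have h2' := (hprop d' hd').2.1
        rw [← heq] at h2'
        exact hm' (part d) ((hadj _).2 h1) c hcu d h2 d' h2' hd.1 hd'.1
    · rw [mul_comm]
      refine mul_le_mul_of_nonneg_right (le_trans ?_ h8) hSpos.le
      have hk : ((L u).card : ℝ) ≤ Δ ^ 2 := by
        have h1 : (G.degree u : ℝ) / Real.log (G.degree u) ≤ 2 * Δ := by
          have hle : (G.degree u : ℝ) ≤ Δ := by exact_mod_cast hdeg u
          rcases Nat.lt_or_ge (G.degree u) 2 with h | h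
          · have h0 : Real.log (G.degree u) = 0 := by
              interval_cases (G.degree u) <;> simp
            rw [h0, div_zero]; positivity
          · have h2 : (2:ℝ) ≤ G.degree u := by exact_mod_cast h
            have h3 : Real.log 2 ≤ Real.log (G.degree u) := Real.log_le_log (by norm_num) h2
            have h4 := Real.log_two_gt_d9
            rw [div_le_iff₀ (by linarith)]
            nlinarith
        have h2 : δ / Real.log δ ≤ 2 * Δ := by
          rw [div_le_iff₀ (by linarith)]
          nlinarith
        rw [hL u]
        have h3 : (1 + ε) * max ((G.degree u : ℝ) / Real.log (G.degree u)) (δ / Real.log δ) ≤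
            4 * Δ := by
          calc _ ≤ (1 + ε) * (2 * Δ) := mul_le_mul_of_nonneg_left (max_le h1 h2) (by linarith)
            _ ≤ _ := by nlinarith
        have h4 : 0 ≤ (1 + ε) *
            max ((G.degree u : ℝ) / Real.log (G.degree u)) (δ / Real.log δ) :=
          mul_nonneg (by linarith) (le_max_of_le_right (div_nonneg hδ0.le (by linarith)))
        have h5 := Nat.ceil_lt_add_one h4
        nlinarith
      have hΔ2 : (Δ : ℝ) ^ 2 = Real.exp (2 * Real.log Δ) := by
        have := Real.exp_nat_mul (Real.log Δ) 2
        rw [Real.exp_log hΔpos] at this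
        exact_mod_cast this.symm
      rw [hΔ2] at hk
      refine (mul_le_mul_of_nonneg_right hk (Real.exp_pos _).le).trans ?_
      rw [← Real.exp_add]
      apply Real.exp_le_exp.2
      have h4 := Real.log_two_gt_d9
      nlinarith
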